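/- If G is a finitely generated periodic (torsion) group, then the subgroup L₁₂ = ⁅L₁,L₂⁆ of the weak commutativity group χ(G) is finite. -/

import Mathlib

open Subgroup

/-- The weak commutativity relations inside the free product `G ∗ G`. -/
def chiRel (G : Type*) [Group G] : Subgroup (Monoid.Coprod G G) :=
  Subgroup.normalClosure
    {x | ∃ g : G, x = Monoid.Coprod.inl g * Monoid.Coprod.inr g *
      (Monoid.Coprod.inl g)⁻¹ * (Monoid.Coprod.inr g)⁻¹}

instance chiRel_normal (G : Type*) [Group G] : (chiRel G).Normal :=
  Subgroup.normalClosure_normal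

/-- The weak commutativity group `χ(G)`. -/
def Chi (G : Type*) [Group G] : Type _ := Monoid.Coprod G G ⧸ chiRel G

instance (G : Type*) [Group G] : Group (Chi G) :=
  inferInstanceAs (Group (Monoid.Coprod G G ⧸ chiRel G))

/-- The canonical map `G → χ(G)`, `g ↦ g`. -/
def chiIota1 (G : Type*) [Group G] : G →* Chi G :=
  (QuotientGroup.mk' (chiRel G)).comp Monoid.Coprod.inl

/-- The canonical map `G → χ(G)`, `g ↦ g^φ`. -/
def chiIota2 (G : Type*) [Group G] : G →* Chi G :=
  (QuotientGroup.mk' (chiRel G)).comp Monoid.Coprod.inr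

/-- `G₁ ≤ χ(G)`. -/
def chiG1 (G : Type*) [Group G] : Subgroup (Chi G) := (chiIota1 G).range

/-- `G₂ = G^φ ≤ χ(G)`. -/
def chiG2 (G : Type*) [Group G] : Subgroup (Chi G) := (chiIota2 G).range

/-- `L = ⟨g⁻¹ g^φ : g ∈ G⟩`. -/
def chiL (G : Type*) [Group G] : Subgroup (Chi G) :=
  Subgroup.closure {x | ∃ g : G, x = (chiIota1 G g)⁻¹ * chiIota2 G g}

/-- `D = ⁅G₁, G₂⁆`. -/
def chiD (G : Type*) [Group G] : Subgroup (Chi G) := ⁅chiG1 G, chiG2 G⁆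

/-- `L₁ = ⁅L, G₁⁆`. -/
def chiL1 (G : Type*) [Group G] : Subgroup (Chi G) := ⁅chiL G, chiG1 G⁆

/-- `L₂ = ⁅L, G₂⁆`. -/
def chiL2 (G : Type*) [Group G] : Subgroup (Chi G) := ⁅chiL G, chiG2 G⁆

/-- `R = ⁅⁅G₁, L⁆, G₂⁆`. -/
def chiR (G : Type*) [Group G] : Subgroup (Chi G) := ⁅⁅chiG1 G, chiL G⁆, chiG2 G⁆

/-- `L₁₂ = ⁅L₁, L₂⁆`. -/
def chiL12 (G : Type*) [Group G] : Subgroup (Chi G) := ⁅chiL1 G, chiL2 G⁆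

open scoped commutatorElement

section Abstract

/-- The abelian group generated by finitely many commuting torsion elements is finite. -/
theorem aux_finite_closure {X : Type*} [Group X] (S : Set X) (hS : S.Finite)
    (hc : ∀ x ∈ S, ∀ y ∈ S, x * y = y * x)
    (ht : ∀ x ∈ S, ∃ n : ℕ, 0 < n ∧ x ^ n = 1) : Finite (closure S) := by
  let _ : CommGroup (closure S) := closureCommGroupOfComm hc
  have : Group.FG (closure S) := by
    have := hS.to_subtype
    exact Group.closure_finite_fg S
  have key : ∀ x (hx : x ∈ closure S), IsOfFinOrder (⟨x, hx⟩ : closure S) := by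
    intro x hx
    induction hx using closure_induction with
    | mem x hx =>
      obtain ⟨n, hn, h⟩ := ht x hx
      exact isOfFinOrder_iff_pow_eq_one.2 ⟨n, hn, Subtype.ext h⟩
    | one => exact IsOfFinOrder.one
    | mul x y hx hy h1 h2 => exact h1.mul h2
    | inv x hx h1 => exact h1.inv
  exact CommGroup.finite_of_fg_isMulTorsion _ (fun x => key x.1 x.2)

theorem aux_fg_torsion_ab {G : Type*} [Group G] (hfg : Group.FG G)
    (hG : ∀ g : G, ∃ n : ℕ, 0 < n ∧ g ^ n = 1) : Finite (Abelianization G) := by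
  have : Group.FG (Abelianization G) :=
    Group.fg_of_surjective (f := Abelianization.of) (QuotientGroup.mk'_surjective _)
  refine CommGroup.finite_of_fg_isMulTorsion _ (fun x => ?_)
  obtain ⟨g, rfl⟩ : ∃ g, Abelianization.of g = x := QuotientGroup.mk'_surjective _ x
  obtain ⟨n, hn, h⟩ := hG g
  exact isOfFinOrder_iff_pow_eq_one.2 ⟨n, hn, by rw [← map_pow, h, map_one]⟩

theorem aux_rep {X G : Type*} [Group X] [Group G] (hfg : Group.FG G)
    (hG : ∀ g : G, ∃ n : ℕ, 0 < n ∧ g ^ n = 1) (A B D : Subgroup X) (p : X →* G)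
    (hAB : ∀ a ∈ A, ∀ b ∈ B, ⁅b, a⁆ ∈ D)
    (hDA : ∀ d ∈ D, ∀ a ∈ A, d * a = a * d)
    (hDB : ∀ d ∈ D, ∀ b ∈ B, d * b = b * d)
    (hker : ∀ a ∈ A, p a = 1 → a ∈ D)
    (hcomm : commutator G ≤ A.map p) :
    ∃ S : Set X, S.Finite ∧ S ⊆ A ∧ ∀ a ∈ A, ∃ s ∈ S, ∀ b ∈ B, ⁅a, b⁆ = ⁅s, b⁆ := by
  have hab : Finite (Abelianization G) := aux_fg_torsion_ab hfg hG
  have hci : (commutator G).FiniteIndex := by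
    have : Finite (G ⧸ commutator G) := hab
    exact finiteIndex_of_finite_quotient
  have : (A.map p).FiniteIndex := finiteIndex_of_le hcomm
  have hfin : Finite (Abelianization (A.map p)) := by
    refine aux_fg_torsion_ab inferInstance ?_
    intro g
    obtain ⟨n, hn, h⟩ := hG g
    exact ⟨n, hn, Subtype.ext h⟩
  have hN : ∀ a ∈ A, ∀ a' ∈ A, ∀ b ∈ B, ⁅a, a'⁆ * b = b * ⁅a, a'⁆ := by
    intro a ha a' ha' b hb
    have hz := hAB a ha b hb
    have hz' := hAB a' ha' b hb
    have e1 : MulAut.conj b a = ⁅b, a⁆ * a := by simp [commutatorElement_def]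
    have e2 : MulAut.conj b a' = ⁅b, a'⁆ * a' := by simp [commutatorElement_def]
    generalize ⁅b, a⁆ = z at *
    have c1 : z * a = a * z := hDA z hz a ha
    have c2 : z * a' = a' * z := hDA z hz a' ha'
    generalize hw : ⁅b, a'⁆ = w at *
    have c3 : w * a = a * w := hDA w hz' a ha
    have c4 : w * a' = a' * w := hDA w hz' a' ha'
    have c5 : z * w = w * z := by
      have := hDA z hz a' ha'
      have h2 := hDB z hz b hb
      have C1 : Commute z a' := this
      have C2 : Commute z b := h2
      rw [← hw, commutatorElement_def]
      exact (((C2.mul_right C1).mul_right C2.inv_right).mul_right C1.inv_right)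
    have e3 : MulAut.conj b ⁅a, a'⁆ = ⁅a, a'⁆ := by
      rw [map_commutatorElement, e1, e2]
      have C1 : Commute z a := c1
      have C2 : Commute z a' := c2
      have C3 : Commute w a := c3
      have C4 : Commute w a' := c4
      have C5 : Commute z w := c5
      have s1 : ⁅z * a, w * a'⁆ = ⁅a, w * a'⁆ := by
        have C : Commute z (a * (w * a') * a⁻¹) :=
          (C1.mul_right (C5.mul_right C2)).mul_right C1.inv_right
        calc ⁅z * a, w * a'⁆ = z * (a * (w * a') * a⁻¹) * z⁻¹ * (w * a')⁻¹ := by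
              simp only [commutatorElement_def]; group
          _ = _ := by rw [C.eq]; simp only [commutatorElement_def]; group
      rw [s1]
      calc ⁅a, w * a'⁆ = (a * w) * a' * a⁻¹ * a'⁻¹ * w⁻¹ := by
            simp only [commutatorElement_def]; group
        _ = w * ⁅a, a'⁆ * w⁻¹ := by rw [← c3]; simp only [commutatorElement_def]; group
        _ = ⁅a, a'⁆ := by
            have C : Commute w ⁅a, a'⁆ :=
              ((C3.mul_right C4).mul_right C3.inv_right).mul_right C4.inv_right
            rw [C.eq]; group
    rw [MulAut.conj_apply] at e3
    rw [mul_inv_eq_iff_eq_mul] at e3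
    exact e3.symm
  -- the centralizing part
  have hN2 : ∀ h ∈ ⁅A.map p, A.map p⁆, ∃ n ∈ A, p n = h ∧ ∀ b ∈ B, n * b = b * n := by
    intro h hh
    rw [← map_commutator] at hh
    obtain ⟨n, hn, rfl⟩ := hh
    refine ⟨n, ?_, rfl, ?_⟩
    · exact commutator_le_self A hn
    · have : ⁅A, A⁆ ≤ centralizer (B : Set X) := by
        rw [commutator_le]
        intro a ha a' ha'
        rw [mem_centralizer_iff]
        intro b hb
        exact (hN a ha a' ha' b hb).symm
      intro b hb
      exact ((mem_centralizer_iff.1 (this hn)) b hb).symm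
  have lift : ∀ q : Abelianization (A.map p), ∃ a : X, ∃ ha : a ∈ A,
      Abelianization.of (⟨p a, mem_map_of_mem p ha⟩ : A.map p) = q := by
    intro q
    obtain ⟨⟨_, a, ha, rfl⟩, rfl⟩ := QuotientGroup.mk'_surjective _ q
    exact ⟨a, ha, rfl⟩
  choose f hf hfq using lift
  refine ⟨Set.range f, Set.finite_range f, ?_, ?_⟩
  · rintro _ ⟨q, rfl⟩; exact hf q
  intro a ha
  refine ⟨_, ⟨Abelianization.of (⟨p a, mem_map_of_mem p ha⟩ : A.map p), rfl⟩, ?_⟩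
  have h1 := hfq (Abelianization.of (⟨p a, mem_map_of_mem p ha⟩ : A.map p))
  have h2 := hf (Abelianization.of (⟨p a, mem_map_of_mem p ha⟩ : A.map p))
  set s := f (Abelianization.of (⟨p a, mem_map_of_mem p ha⟩ : A.map p)) with hs
  clear_value s
  have h3 := (QuotientGroup.eq.1 h1 : _ ∈ commutator (A.map p))
  have h4 : (p s)⁻¹ * p a ∈ ⁅A.map p, A.map p⁆ := by
    have := mem_map_of_mem (A.map p).subtype h3
    rw [map_subtype_commutator] at this
    rw [hs]
    exact this
  obtain ⟨n, hn, hpn, hnb⟩ := hN2 _ h4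
  have h5 : n⁻¹ * (s⁻¹ * a) ∈ D := by
    apply hker
    · exact A.mul_mem (A.inv_mem hn) (A.mul_mem (A.inv_mem h2) ha)
    · simp [hpn]
  intro b hb
  have h6 : Commute (n * (n⁻¹ * (s⁻¹ * a))) b :=
    Commute.mul_left (hnb b hb) (hDB _ h5 b hb)
  have h7 : a = s * (n * (n⁻¹ * (s⁻¹ * a))) := by group
  generalize n * (n⁻¹ * (s⁻¹ * a)) = c at *
  subst h7
  calc ⁅s * c, b⁆ = s * (c * b) * c⁻¹ * s⁻¹ * b⁻¹ := by
        simp only [commutatorElement_def]; group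
    _ = _ := by rw [h6.eq]; simp only [commutatorElement_def]; group

theorem aux_main {X G : Type*} [Group X] [Group G] (hfg : Group.FG G)
    (hG : ∀ g : G, ∃ n : ℕ, 0 < n ∧ g ^ n = 1) (A B D : Subgroup X) (p q : X →* G)
    (hAB : ∀ a ∈ A, ∀ b ∈ B, ⁅a, b⁆ ∈ D)
    (hDA : ∀ d ∈ D, ∀ a ∈ A, d * a = a * d)
    (hDB : ∀ d ∈ D, ∀ b ∈ B, d * b = b * d)
    (hkerA : ∀ a ∈ A, p a = 1 → a ∈ D)
    (hkerB : ∀ a ∈ B, q a = 1 → a ∈ D)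
    (hA : commutator G ≤ A.map p) (hB : commutator G ≤ B.map q) :
    Finite (⁅A, B⁆ : Subgroup X) := by
  have hBA : ∀ a ∈ A, ∀ b ∈ B, ⁅b, a⁆ ∈ D := by
    intro a ha b hb
    rw [← commutatorElement_inv]
    exact D.inv_mem (hAB a ha b hb)
  obtain ⟨S, hS, hSA, hS'⟩ := aux_rep hfg hG A B D p hBA hDA hDB hkerA hA
  obtain ⟨T, hT, hTB, hT'⟩ := aux_rep hfg hG B A D q
    (fun b hb a ha => hAB a ha b hb) hDB hDA hkerB hB
  have hfin : {x | ∃ a ∈ A, ∃ b ∈ B, ⁅a, b⁆ = x}.Finite := by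
    refine (hS.image2 (fun s t => ⁅s, t⁆) hT).subset ?_
    rintro _ ⟨a, ha, b, hb, rfl⟩
    obtain ⟨s, hs, h1⟩ := hS' a ha
    obtain ⟨t, ht, h2⟩ := hT' b hb
    refine ⟨s, hs, t, ht, ?_⟩
    have := h2 s (hSA hs)
    change ⁅s, t⁆ = _
    rw [h1 b hb, ← commutatorElement_inv, ← this, commutatorElement_inv]
  rw [Subgroup.commutator_def]
  refine aux_finite_closure _ hfin ?_ ?_
  · rintro x ⟨a, ha, b, hb, rfl⟩ _ ⟨a', ha', b', hb', rfl⟩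
    have h := hAB a ha b hb
    have C1 : Commute ⁅a, b⁆ a' := hDA _ h _ ha'
    have C2 : Commute ⁅a, b⁆ b' := hDB _ h _ hb'
    exact ((C1.mul_right C2).mul_right C1.inv_right).mul_right C2.inv_right
  · rintro x ⟨a, ha, b, hb, rfl⟩
    obtain ⟨n, hn, h⟩ := hG (p a)
    refine ⟨n, hn, ?_⟩
    have h1 : a ^ n ∈ D := hkerA _ (A.pow_mem ha n) (by simpa using h)
    have key : ∀ m : ℕ, ⁅a, b⁆ ^ m = ⁅a ^ m, b⁆ := by
      intro m
      induction m with
      | zero => simp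
      | succ m ih =>
        have C : Commute ⁅a, b⁆ (a ^ m) := Commute.pow_right (hDA _ (hAB a ha b hb) _ ha) m
        rw [pow_succ', ih]
        calc ⁅a, b⁆ * ⁅a ^ m, b⁆ = (⁅a, b⁆ * a ^ m) * b * (a ^ m)⁻¹ * b⁻¹ := by
              simp only [commutatorElement_def]; group
          _ = _ := by
            rw [C.eq, pow_succ]; simp only [commutatorElement_def]; group
    rw [key, commutatorElement_eq_one_iff_mul_comm]
    exact hDB _ h1 _ hb

end Abstract

section ChiFacts

variable {G : Type*} [Group G]

theorem chi_comm (g : G) : Commute (chiIota1 G g) (chiIota2 G g) := by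
  have : (QuotientGroup.mk' (chiRel G)) (Monoid.Coprod.inl g * Monoid.Coprod.inr g *
      (Monoid.Coprod.inl g)⁻¹ * (Monoid.Coprod.inr g)⁻¹) = 1 := by
    rw [← MonoidHom.mem_ker, QuotientGroup.ker_mk']
    exact subset_normalClosure ⟨g, rfl⟩
  simp only [map_mul, map_inv] at this
  rw [mul_inv_eq_one, mul_inv_eq_iff_eq_mul] at this
  exact this

/-- Maps out of `χ(G)`. -/
theorem chi_lift {H : Type*} [Group H] (f g : G →* H) (h : ∀ x, Commute (f x) (g x)) :
    ∃ F : Chi G →* H, (∀ x, F (chiIota1 G x) = f x) ∧ ∀ x, F (chiIota2 G x) = g x := by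
  have hle : chiRel G ≤ (Monoid.Coprod.lift f g).ker := by
    apply normalClosure_le_normal
    rintro _ ⟨x, rfl⟩
    rw [SetLike.mem_coe, MonoidHom.mem_ker]
    simp [(h x).eq]
  refine ⟨QuotientGroup.lift (chiRel G) (Monoid.Coprod.lift f g) hle, ?_, ?_⟩
  · intro x
    exact Monoid.Coprod.lift_apply_inl f g x
  · intro x
    exact Monoid.Coprod.lift_apply_inr f g x

theorem chi_swap (h k : G) :
    ⁅chiIota2 G h, chiIota1 G k⁆ = ⁅chiIota1 G h, chiIota2 G k⁆ := by
  have e := (chi_comm (h⁻¹ * k)).eq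
  have ch := (chi_comm h)
  have ck := (chi_comm k)
  simp only [map_mul, map_inv] at e
  generalize chiIota1 G h = a at *
  generalize chiIota2 G h = a' at *
  generalize chiIota1 G k = b at *
  generalize chiIota2 G k = b' at *
  simp only [commutatorElement_def]
  calc a' * b * a'⁻¹ * b⁻¹ = (a * a') * (a⁻¹ * b * (a'⁻¹ * b')) * (b * b')⁻¹ := by
        rw [ch.eq]; group
    _ = a * b' * a⁻¹ * b'⁻¹ := by rw [e]; rw [ck.eq]; group

theorem chi_DL_gen (x z y : G) :
    Commute ⁅chiIota1 G x, chiIota2 G z⁆ ((chiIota1 G y)⁻¹ * chiIota2 G y) := by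
  have e := chi_swap (y * x) z
  have e1 := chi_swap x z
  have e2 := chi_swap y z
  simp only [map_mul] at e
  have f1 : ⁅chiIota2 G y * chiIota2 G x, chiIota1 G z⁆ =
      chiIota2 G y * ⁅chiIota2 G x, chiIota1 G z⁆ * (chiIota2 G y)⁻¹ *
        ⁅chiIota2 G y, chiIota1 G z⁆ := by
    simp only [commutatorElement_def]; group
  have f2 : ⁅chiIota1 G y * chiIota1 G x, chiIota2 G z⁆ =
      chiIota1 G y * ⁅chiIota1 G x, chiIota2 G z⁆ * (chiIota1 G y)⁻¹ *
        ⁅chiIota1 G y, chiIota2 G z⁆ := by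
    simp only [commutatorElement_def]; group
  rw [f1, f2, e1, e2] at e
  have e := mul_right_cancel e
  generalize ⁅chiIota1 G x, chiIota2 G z⁆ = c at *
  rw [mul_inv_eq_iff_eq_mul] at e
  change c * _ = _ * c
  rw [mul_assoc _ _ c, e]
  group

theorem chi_DL : ∀ d ∈ chiD G, ∀ l ∈ chiL G, d * l = l * d := by
  have h1 : chiL G ≤ centralizer (chiD G : Set (Chi G)) := by
    rw [chiL, closure_le]
    rintro _ ⟨y, rfl⟩
    rw [SetLike.mem_coe, mem_centralizer_iff]
    intro d hd
    have h2 : chiD G ≤ centralizer {(chiIota1 G y)⁻¹ * chiIota2 G y} := by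
      rw [chiD, commutator_le]
      rintro _ ⟨x, rfl⟩ _ ⟨z, rfl⟩
      rw [mem_centralizer_iff]
      rintro _ rfl
      exact (chi_DL_gen x z y).eq.symm
    exact (mem_centralizer_iff.1 (h2 hd) _ rfl).symm
  intro d hd l hl
  exact mem_centralizer_iff.1 (h1 hl) d hd

theorem chi_form (x : Chi G) : ∃ g h : G, ∃ d ∈ chiD G, x = chiIota1 G g * chiIota2 G h * d := by
  obtain ⟨w, rfl⟩ := QuotientGroup.mk'_surjective (chiRel G) x
  induction w using Monoid.Coprod.induction_on' with
  | one => exact ⟨1, 1, 1, one_mem _, by simp only [map_one, mul_one]; rfl⟩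
  | inl_mul k w ih =>
    obtain ⟨g, h, d, hd, e⟩ := ih
    refine ⟨k * g, h, d, hd, ?_⟩
    rw [map_mul, e]
    change chiIota1 G k * _ = _
    simp only [map_mul, mul_assoc]
  | inr_mul k w ih =>
    obtain ⟨g, h, d, hd, e⟩ := ih
    refine ⟨g, k * h, ⁅chiIota1 G g⁻¹, chiIota2 G (k * h)⁻¹⁆⁻¹ * ⁅chiIota1 G g⁻¹, chiIota2 G h⁻¹⁆ * d, ?_, ?_⟩
    · refine mul_mem (mul_mem (inv_mem ?_) ?_) hd
      · exact commutator_mem_commutator ⟨_, rfl⟩ ⟨_, rfl⟩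
      · exact commutator_mem_commutator ⟨_, rfl⟩ ⟨_, rfl⟩
    rw [map_mul, e]
    change chiIota2 G k * _ = _
    simp only [map_mul, map_inv, commutatorElement_def]
    group

theorem chi_conj1 (h : G) (l : Chi G) (hl : l ∈ chiL G) :
    (chiIota1 G h) * l * (chiIota1 G h)⁻¹ ∈ chiL G := by
  induction hl using closure_induction with
  | mem x hx =>
    obtain ⟨g, rfl⟩ := hx
    have h1 : (chiIota1 G (g * h⁻¹))⁻¹ * chiIota2 G (g * h⁻¹) ∈ chiL G :=
      subset_closure ⟨_, rfl⟩
    have h2 : (chiIota1 G h⁻¹)⁻¹ * chiIota2 G h⁻¹ ∈ chiL G := subset_closure ⟨_, rfl⟩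
    have := mul_mem h1 (inv_mem h2)
    convert this using 1
    simp only [map_mul, map_inv]
    group
  | one => simp [one_mem]
  | mul x y hx hy h1 h2 => convert mul_mem h1 h2 using 1; group
  | inv x hx h1 => convert inv_mem h1 using 1; group

theorem chi_L1_le : chiL1 G ≤ chiL G := by
  rw [chiL1, commutator_le]
  rintro l hl _ ⟨h, rfl⟩
  have := mul_mem hl (chi_conj1 h _ (inv_mem hl))
  convert this using 1
  simp only [commutatorElement_def]; group

theorem chi_L2_le : chiL2 G ≤ chiL G := by
  rw [chiL2, commutator_le]
  rintro l hl _ ⟨h, rfl⟩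
  have h1 : (chiIota1 G h)⁻¹ * chiIota2 G h ∈ chiL G := subset_closure ⟨_, rfl⟩
  have := mul_mem hl (chi_conj1 h _ (mul_mem (mul_mem h1 (inv_mem hl)) (inv_mem h1)))
  convert this using 1
  simp only [commutatorElement_def]; group

end ChiFacts

theorem chiL12_finite_of_fg_periodic (G : Type*) [Group G] (hfg : Group.FG G)
    (hG : ∀ g : G, ∃ n : ℕ, 0 < n ∧ g ^ n = 1) :
    Finite (chiL12 G) := by
  obtain ⟨p, hp1, hp2⟩ := chi_lift (MonoidHom.id G) (1 : G →* G) (fun x => Commute.one_right _)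
  obtain ⟨q, hq1, hq2⟩ := chi_lift (1 : G →* G) (MonoidHom.id G) (fun x => Commute.one_left _)
  have hD : chiD G ≤ p.ker := by
    rw [chiD, commutator_le]
    rintro _ ⟨x, rfl⟩ _ ⟨y, rfl⟩
    simp [MonoidHom.mem_ker, map_commutatorElement, hp1, hp2]
  have hD' : chiD G ≤ q.ker := by
    rw [chiD, commutator_le]
    rintro _ ⟨x, rfl⟩ _ ⟨y, rfl⟩
    simp [MonoidHom.mem_ker, map_commutatorElement, hq1, hq2]
  have hker : ∀ x, p x = 1 → q x = 1 → x ∈ chiD G := by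
    intro x h1 h2
    obtain ⟨g, h, d, hd, rfl⟩ := chi_form x
    have e1 : p d = 1 := hD hd
    have e2 : q d = 1 := hD' hd
    simp only [map_mul, hp1, hp2, hq1, hq2, e1, e2] at h1 h2
    simp at h1 h2
    subst h1 h2
    simpa using hd
  have hq : ∀ a ∈ chiL1 G, q a = 1 := by
    have : chiL1 G ≤ q.ker := by
      rw [chiL1, commutator_le]
      rintro l _ _ ⟨y, rfl⟩
      simp [MonoidHom.mem_ker, map_commutatorElement, hq1]
    exact fun a ha => this ha
  have hp : ∀ a ∈ chiL2 G, p a = 1 := by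
    have : chiL2 G ≤ p.ker := by
      rw [chiL2, commutator_le]
      rintro l _ _ ⟨y, rfl⟩
      simp [MonoidHom.mem_ker, map_commutatorElement, hp2]
    exact fun a ha => this ha
  refine aux_main hfg hG (chiL1 G) (chiL2 G) (chiD G) p q ?_ ?_ ?_ ?_ ?_ ?_ ?_
  · intro a ha b hb
    apply hker
    · simp [map_commutatorElement, hp b hb]
    · simp [map_commutatorElement, hq a ha]
  · exact fun d hd a ha => chi_DL d hd a (chi_L1_le ha)
  · exact fun d hd a ha => chi_DL d hd a (chi_L2_le ha)
  · exact fun a ha h => hker a h (hq a ha)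
  · exact fun a ha h => hker a (hp a ha) h
  · rw [commutator_def, commutator_le]
    intro g _ h _
    refine ⟨⁅(chiIota1 G g⁻¹)⁻¹ * chiIota2 G g⁻¹, chiIota1 G h⁆,
      commutator_mem_commutator (subset_closure ⟨_, rfl⟩) ⟨_, rfl⟩, ?_⟩
    simp [map_commutatorElement, hp1, hp2]
  · rw [commutator_def, commutator_le]
    intro g _ h _
    refine ⟨⁅(chiIota1 G g)⁻¹ * chiIota2 G g, chiIota2 G h⁆,
      commutator_mem_commutator (subset_closure ⟨_, rfl⟩) ⟨_, rfl⟩, ?_⟩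
    simp [map_commutatorElement, hq1, hq2]
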